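/- Let n ≥ 2 be an integer, p ∈ (1, n) and −n(p−1) < β < n − p. Then for every f ∈ C_c^∞(ℝ^n), ∫_{ℝ^n} |Δ_r f(x)|^p / |x|^β dx ≥ ((n(p−1)+β)/p)^p ∫_{ℝ^n} |∂_r f(x)|^p / |x|^{p+β} dx. -/

import Mathlib

open MeasureTheory

/-- The radial derivative `∂_r f (x) = ⟨x/|x|, ∇f(x)⟩` of `f : ℝⁿ → ℝ`. -/
noncomputable def radDeriv {n : ℕ} (f : EuclideanSpace ℝ (Fin n) → ℝ)
    (x : EuclideanSpace ℝ (Fin n)) : ℝ :=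
  fderiv ℝ f x (‖x‖⁻¹ • x)

/-- The radial Laplacian `Δ_r f = ∂_r² f + ((n-1)/|x|) ∂_r f`. -/
noncomputable def radLap {n : ℕ} (f : EuclideanSpace ℝ (Fin n) → ℝ)
    (x : EuclideanSpace ℝ (Fin n)) : ℝ :=
  radDeriv (radDeriv f) x + ((n : ℝ) - 1) / ‖x‖ * radDeriv f x

open Set Filter Topology Metric

namespace Rellich

/-- `||a|^(p-2) a| = |a|^(p-1)`. -/
lemma abs_rpow_mul_self {p : ℝ} (hp : 1 < p) (a : ℝ) :
    |(|a| ^ (p - 2) * a)| = |a| ^ (p - 1) := by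
  rw [abs_mul, abs_of_nonneg (Real.rpow_nonneg (abs_nonneg a) _)]
  rcases eq_or_ne a 0 with rfl | h
  · have : p - 1 ≠ 0 := by linarith
    simp [Real.zero_rpow this]
  · have : p - 1 = (p - 2) + 1 := by ring
    rw [this, Real.rpow_add_one (abs_ne_zero.2 h)]

lemma young_aux {p : ℝ} (hp : 1 < p) (a L : ℝ) :
    p * (|a| ^ (p - 2) * a * L) ≤ |L| ^ p + (p - 1) * |a| ^ p := by
  have hpq : p.HolderConjugate (p.conjExponent) := Real.HolderConjugate.conjExponent hp
  have h := Real.young_inequality L (|a| ^ (p - 2) * a) hpq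
  have hq : p.conjExponent = p / (p - 1) := rfl
  rw [abs_rpow_mul_self hp, ← Real.rpow_mul (abs_nonneg a), hq] at h
  have h1 : p - 1 ≠ 0 := by linarith
  have h2 : (p - 1) * (p / (p - 1)) = p := by field_simp
  rw [h2] at h
  have h3 := mul_le_mul_of_nonneg_left h (by linarith : 0 ≤ p)
  have h4 : p * (|L| ^ p / p + |a| ^ p / (p / (p - 1))) = |L| ^ p + (p - 1) * |a| ^ p := by
    have : p ≠ 0 := by linarith
    field_simp
  rw [h4] at h3
  calc _ = p * (L * (|a| ^ (p - 2) * a)) := by ring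
    _ ≤ _ := h3

/-- pointwise inequality -/
lemma pointwise_aux {p β c r : ℝ} (hp : 1 < p) (hc : 0 < c) (hr : 0 < r) (a L : ℝ) :
    p * c ^ (p - 1) * (|a| ^ (p - 2) * a * L * r ^ (1 - p - β) - c * |a| ^ p * r ^ (- p - β))
      ≤ |L| ^ p / r ^ β - c ^ p * (|a| ^ p / r ^ (p + β)) := by
  have h := young_aux hp (c / r * a) L
  have hcr : 0 < c / r := by positivity
  rw [abs_mul, abs_of_pos hcr, Real.mul_rpow hcr.le (abs_nonneg a),
    Real.mul_rpow hcr.le (abs_nonneg a)] at h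
  have e1 : (c / r) ^ (p - 2) * |a| ^ (p - 2) * (c / r * a) * L
      = (c / r) ^ (p - 1) * (|a| ^ (p - 2) * a * L) := by
    have : p - 1 = (p - 2) + 1 := by ring
    rw [this, Real.rpow_add_one hcr.ne']; ring
  rw [e1] at h
  rw [Real.div_rpow hc.le hr.le, Real.div_rpow hc.le hr.le] at h
  have hb : 0 < r ^ β := by positivity
  have h5 := mul_le_mul_of_nonneg_right h (inv_pos.2 hb).le
  have i1 : r ^ (1 - p - β) = (r ^ (p - 1))⁻¹ * (r ^ β)⁻¹ := by
    rw [← Real.rpow_neg hr.le, ← Real.rpow_neg hr.le, ← Real.rpow_add hr]; congr 1; ring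
  have i2 : r ^ (-p - β) = (r ^ p)⁻¹ * (r ^ β)⁻¹ := by
    rw [← Real.rpow_neg hr.le, ← Real.rpow_neg hr.le, ← Real.rpow_add hr]; congr 1
  have i3 : r ^ (p + β) = r ^ p * r ^ β := Real.rpow_add hr _ _
  have i4 : c ^ p = c ^ (p - 1) * c := by
    rw [← Real.rpow_add_one hc.ne']; congr 1; ring
  rw [i1, i2, i3]
  rw [i4] at h5 ⊢
  simp only [div_eq_mul_inv, mul_inv] at h5 ⊢
  linarith

/-- polar coordinates -/
lemma integral_eq_zero_of_rays {n : ℕ} (hn : 2 ≤ n) (G : EuclideanSpace ℝ (Fin n) → ℝ)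
    (hG : Integrable G)
    (h : ∀ w : EuclideanSpace ℝ (Fin n), ‖w‖ = 1 →
      IntegrableOn (fun r : ℝ => r ^ (n - 1) * G (r • w)) (Ioi 0) →
      ∫ r in Ioi (0 : ℝ), r ^ (n - 1) * G (r • w) = 0) :
    ∫ x, G x = 0 := by
  have hdim : Module.finrank ℝ (EuclideanSpace ℝ (Fin n)) = n := by simp
  have : Nontrivial (EuclideanSpace ℝ (Fin n)) := Module.nontrivial_of_finrank_pos (R := ℝ) (by rw [hdim]; omega)
  have hmp := (volume : Measure (EuclideanSpace ℝ (Fin n))).measurePreserving_homeomorphUnitSphereProd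
  rw [hdim] at hmp
  set H : sphere (0 : (EuclideanSpace ℝ (Fin n))) 1 × Ioi (0 : ℝ) → ℝ := fun z => G ((z.2 : ℝ) • (z.1 : (EuclideanSpace ℝ (Fin n)))) with hH
  have key : (fun x : ({(0 : (EuclideanSpace ℝ (Fin n)))}ᶜ : Set (EuclideanSpace ℝ (Fin n))) => H (homeomorphUnitSphereProd (EuclideanSpace ℝ (Fin n)) x))
      = fun x => G x.1 := by
    funext x
    have hx : ‖(x : (EuclideanSpace ℝ (Fin n)))‖ ≠ 0 := norm_ne_zero_iff.2 x.2
    simp [hH, smul_smul, hx]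
  have e1 : ∫ x, G x = ∫ z, H z ∂((volume : Measure (EuclideanSpace ℝ (Fin n))).toSphere.prod (.volumeIoiPow (n - 1))) := by
    rw [← hmp.integral_comp (Homeomorph.measurableEmbedding _) H, key,
      integral_subtype_comap (measurableSet_singleton _).compl G, restrict_compl_singleton]
  have i1 : Integrable H ((volume : Measure (EuclideanSpace ℝ (Fin n))).toSphere.prod (.volumeIoiPow (n - 1))) := by
    rw [← hmp.integrable_comp_emb (Homeomorph.measurableEmbedding _), Function.comp_def, key]
    have := hG
    rw [← restrict_compl_singleton (μ := (volume : Measure (EuclideanSpace ℝ (Fin n)))) 0, ← IntegrableOn,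
      integrableOn_iff_comap_subtypeVal (measurableSet_singleton _).compl] at this
    exact this
  rw [e1, integral_prod _ i1]
  refine integral_eq_zero_of_ae ?_
  filter_upwards [i1.prod_right_ae] with w hw
  have hw1 : ‖(w : (EuclideanSpace ℝ (Fin n)))‖ = 1 := by simp
  have hI : IntegrableOn (fun r : ℝ => r ^ (n - 1) * G (r • (w : (EuclideanSpace ℝ (Fin n))))) (Ioi 0) := by
    rw [integrableOn_iff_comap_subtypeVal measurableSet_Ioi]
    rw [Measure.volumeIoiPow, integrable_withDensity_iff_integrable_smul'] at hw
    · refine hw.congr (.of_forall ?_)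
      rintro ⟨x, hx : 0 < x⟩
      simp (disch := positivity) [hH, ENNReal.toReal_ofReal]
    · fun_prop
    · simp
  refine Eq.trans ?_ (h w hw1 hI)
  simp only [Measure.volumeIoiPow, ENNReal.ofReal]
  rw [integral_withDensity_eq_integral_smul,
    integral_subtype_comap measurableSet_Ioi
      fun a ↦ Real.toNNReal (a ^ (n - 1)) • G (a • (w : (EuclideanSpace ℝ (Fin n)))),
    setIntegral_congr_fun measurableSet_Ioi fun x hx ↦ ?_]
  · simp only [NNReal.smul_def, smul_eq_mul]
    rw [Real.coe_toNNReal _ (pow_nonneg hx.out.le _)]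
  · exact (measurable_subtype_coe.pow_const _).real_toNNReal

section
variable {n : ℕ}

lemma radDeriv_ray (f : EuclideanSpace ℝ (Fin n) → ℝ) {w : EuclideanSpace ℝ (Fin n)}
    (hw : ‖w‖ = 1) {s : ℝ} (hs : 0 < s) : radDeriv f (s • w) = fderiv ℝ f (s • w) w := by
  unfold radDeriv
  congr 1
  rw [norm_smul, hw, mul_one, Real.norm_of_nonneg hs.le, smul_smul, inv_mul_cancel₀ hs.ne',
    one_smul]

lemma differentiableAt_radDeriv {f : EuclideanSpace ℝ (Fin n) → ℝ}
    (hf : ContDiff ℝ (⊤ : ℕ∞) f) {x : EuclideanSpace ℝ (Fin n)} (hx : x ≠ 0) :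
    DifferentiableAt ℝ (radDeriv f) x := by
  have h1 : DifferentiableAt ℝ (fderiv ℝ f) x :=
    (hf.fderiv_right (m := 1) (by norm_cast)).differentiable (by simp) x
  have h2 : DifferentiableAt ℝ (fun x : EuclideanSpace ℝ (Fin n) => ‖x‖⁻¹ • x) x :=
    ((differentiableAt_id.norm ℝ hx).inv (norm_ne_zero_iff.2 hx)).smul differentiableAt_id
  exact h1.clm_apply h2

lemma hasDerivAt_ray {f : EuclideanSpace ℝ (Fin n) → ℝ}
    (hf : ContDiff ℝ (⊤ : ℕ∞) f) (w : EuclideanSpace ℝ (Fin n)) (s : ℝ) :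
    HasDerivAt (fun s : ℝ => fderiv ℝ f (s • w) w) (fderiv ℝ (fderiv ℝ f) (s • w) w w) s := by
  have h1 : DifferentiableAt ℝ (fderiv ℝ f) (s • w) :=
    (hf.fderiv_right (m := 1) (by norm_cast)).differentiable (by simp) _
  have h2 : HasDerivAt (fun s : ℝ => s • w) w s := by
    simpa using (hasDerivAt_id s).smul_const w
  have h3 := h1.hasFDerivAt.comp_hasDerivAt s h2
  simpa using h3.clm_apply (hasDerivAt_const s w)

lemma radDeriv2_ray {f : EuclideanSpace ℝ (Fin n) → ℝ}
    (hf : ContDiff ℝ (⊤ : ℕ∞) f) {w : EuclideanSpace ℝ (Fin n)}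
    (hw : ‖w‖ = 1) {s : ℝ} (hs : 0 < s) :
    radDeriv (radDeriv f) (s • w) = fderiv ℝ (fderiv ℝ f) (s • w) w w := by
  rw [radDeriv_ray _ hw hs]
  have hne : s • w ≠ 0 := by
    rw [← norm_ne_zero_iff, norm_smul, hw]; simpa using hs.ne'
  have h2 : HasDerivAt (fun s : ℝ => s • w) w s := by
    simpa using (hasDerivAt_id s).smul_const w
  have h3 := (differentiableAt_radDeriv hf hne).hasFDerivAt.comp_hasDerivAt s h2
  refine h3.unique ?_
  refine (hasDerivAt_ray hf w s).congr_of_eventuallyEq ?_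
  filter_upwards [lt_mem_nhds hs] with t ht
  exact radDeriv_ray f hw ht

lemma measurable_radDeriv (f : EuclideanSpace ℝ (Fin n) → ℝ) : Measurable (radDeriv f) := by
  unfold radDeriv
  exact ContinuousLinearMap.measurable_apply₂.comp
    ((measurable_fderiv ℝ f).prodMk (measurable_norm.inv.smul measurable_id))

lemma measurable_radLap (f : EuclideanSpace ℝ (Fin n) → ℝ) : Measurable (radLap f) := by
  unfold radLap
  exact (measurable_radDeriv _).add ((measurable_const.div measurable_norm).mul
    (measurable_radDeriv f))

lemma fderiv_bound {E F : Type*} [NormedAddCommGroup E] [NormedSpace ℝ E]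
    [NormedAddCommGroup F] [NormedSpace ℝ F] {g : E → F} (hg : ContDiff ℝ 1 g)
    (hc : HasCompactSupport g) : ∃ C : ℝ, ∀ x, ‖fderiv ℝ g x‖ ≤ C := by
  have h1 : Continuous (fderiv ℝ g) := hg.continuous_fderiv (by simp)
  have h2 : HasCompactSupport (fderiv ℝ g) := hc.fderiv (𝕜 := ℝ)
  exact h2.exists_bound_of_continuous h1

/-- uniform bounds -/
lemma bounds {f : EuclideanSpace ℝ (Fin n) → ℝ} (hn : 2 ≤ n)
    (hf : ContDiff ℝ (⊤ : ℕ∞) f) (hfc : HasCompactSupport f) :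
    ∃ R C : ℝ, 0 < R ∧ 0 < C ∧
      (∀ x, R ≤ ‖x‖ → fderiv ℝ f x = 0) ∧
      (∀ x, |radDeriv f x| ≤ C) ∧ (∀ x, x ≠ 0 → |radLap f x| ≤ C / ‖x‖) ∧
      (∀ x, R ≤ ‖x‖ → radDeriv f x = 0 ∧ radLap f x = 0) := by
  have hd1 : ContDiff ℝ 1 (fderiv ℝ f) := hf.fderiv_right (m := 1) (by norm_cast)
  have hc1 : HasCompactSupport (fderiv ℝ f) := hfc.fderiv (𝕜 := ℝ)
  obtain ⟨C1, hC1⟩ := hc1.exists_bound_of_continuous hd1.continuous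
  obtain ⟨C2, hC2⟩ := fderiv_bound hd1 hc1
  obtain ⟨R0, hR0⟩ := hfc.isCompact.isBounded.subset_ball (0 : EuclideanSpace ℝ (Fin n))
  have hC1' : 0 ≤ C1 := (norm_nonneg _).trans (hC1 0)
  have hC2' : 0 ≤ C2 := (norm_nonneg _).trans (hC2 0)
  have hn' : (2 : ℝ) ≤ n := by exact_mod_cast hn
  obtain ⟨R, hR, hRR⟩ : ∃ R : ℝ, 0 < R ∧ R0 ≤ R :=
    ⟨max R0 1, lt_of_lt_of_le one_pos (le_max_right _ _), le_max_left _ _⟩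
  have hts : ∀ x, R ≤ ‖x‖ → x ∉ tsupport f := by
    intro x hx hxs
    have := hR0 hxs
    rw [mem_ball_zero_iff] at this
    linarith
  have hz1 : ∀ x, R ≤ ‖x‖ → fderiv ℝ f x = 0 := by
    intro x hx
    exact fderiv_of_notMem_tsupport (𝕜 := ℝ) (hts x hx)
  have hz2 : ∀ x, R ≤ ‖x‖ → fderiv ℝ (fderiv ℝ f) x = 0 := by
    intro x hx
    exact fderiv_of_notMem_tsupport (𝕜 := ℝ)
      (fun h => hts x hx (tsupport_fderiv_subset ℝ h))
  have hray : ∀ x : EuclideanSpace ℝ (Fin n), x ≠ 0 → ∃ w : EuclideanSpace ℝ (Fin n),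
      ‖w‖ = 1 ∧ 0 < ‖x‖ ∧ x = ‖x‖ • w := by
    intro x hx
    have h0 : ‖x‖ ≠ 0 := norm_ne_zero_iff.2 hx
    refine ⟨‖x‖⁻¹ • x, ?_, norm_pos_iff.2 hx, ?_⟩
    · rw [norm_smul, norm_inv, norm_norm, inv_mul_cancel₀ h0]
    · rw [smul_smul, mul_inv_cancel₀ h0, one_smul]
  have h2 : ∀ x : EuclideanSpace ℝ (Fin n), x ≠ 0 → ∃ w : EuclideanSpace ℝ (Fin n),
      ‖w‖ = 1 ∧ radDeriv (radDeriv f) x = fderiv ℝ (fderiv ℝ f) x w w := by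
    intro x hx
    obtain ⟨w, hw, hp, hxw⟩ := hray x hx
    refine ⟨w, hw, ?_⟩
    have := radDeriv2_ray hf hw hp
    rwa [← hxw] at this
  have hb1 : ∀ x, |radDeriv f x| ≤ C1 := by
    intro x
    unfold radDeriv
    refine ((fderiv ℝ f x).le_opNorm _).trans ?_
    have : ‖‖x‖⁻¹ • x‖ ≤ 1 := by
      rw [norm_smul, norm_inv, norm_norm]; exact inv_mul_le_one
    calc _ ≤ C1 * 1 := mul_le_mul (hC1 x) this (norm_nonneg _) hC1'
      _ = C1 := mul_one _
  have hb2 : ∀ x, x ≠ 0 → |radDeriv (radDeriv f) x| ≤ C2 := by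
    intro x hx
    obtain ⟨w, hw, h⟩ := h2 x hx
    rw [h]
    have := (fderiv ℝ (fderiv ℝ f) x).le_opNorm₂ w w
    rw [hw, mul_one, mul_one] at this
    exact this.trans (hC2 x)
  have hzz : ∀ x, R ≤ ‖x‖ → radDeriv f x = 0 ∧ radLap f x = 0 := by
    intro x hx
    have hx0 : x ≠ 0 := norm_pos_iff.1 (hR.trans_le hx)
    have h1 : radDeriv f x = 0 := by unfold radDeriv; rw [hz1 x hx]; rfl
    obtain ⟨w, hw, h⟩ := h2 x hx0
    refine ⟨h1, ?_⟩
    unfold radLap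
    rw [h, hz2 x hx, h1]; simp
  refine ⟨R, C1 + (C2 * R + (n - 1) * C1) + 1, hR, ?_, hz1, ?_, ?_, hzz⟩
  · have : 0 ≤ (n - 1 : ℝ) * C1 := mul_nonneg (by linarith) hC1'
    positivity
  · intro x
    have : 0 ≤ (n - 1 : ℝ) * C1 := mul_nonneg (by linarith) hC1'
    have : 0 ≤ C2 * R := by positivity
    linarith [hb1 x]
  · intro x hx
    have hpos : 0 < ‖x‖ := norm_pos_iff.2 hx
    have hnn : 0 ≤ (n - 1 : ℝ) * C1 := mul_nonneg (by linarith) hC1'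
    have hnn2 : 0 ≤ C2 * R := by positivity
    rcases le_or_gt R ‖x‖ with h | h
    · rw [(hzz x h).2, abs_zero]; positivity
    · rw [le_div_iff₀ hpos]
      unfold radLap
      have e : |radDeriv (radDeriv f) x + ((n : ℝ) - 1) / ‖x‖ * radDeriv f x| * ‖x‖
          = |radDeriv (radDeriv f) x * ‖x‖ + ((n : ℝ) - 1) * radDeriv f x| := by
        rw [← abs_of_pos hpos, ← abs_mul, abs_of_pos hpos]; congr 1; field_simp
      rw [e]
      refine (abs_add_le _ _).trans ?_
      rw [abs_mul, abs_mul, abs_of_pos hpos, abs_of_nonneg (by linarith : (0 : ℝ) ≤ n - 1)]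
      have := mul_le_mul (hb2 x hx) h.le hpos.le hC2'
      have := mul_le_mul_of_nonneg_left (hb1 x) (by linarith : (0 : ℝ) ≤ n - 1)
      linarith

lemma integrable_dom (hn : 2 ≤ n) {s : ℝ} (hs : s < n) (R K : ℝ) :
    Integrable (fun x : EuclideanSpace ℝ (Fin n) =>
      (Iio R).indicator (fun r : ℝ => K * r ^ (-s)) ‖x‖) := by
  have hdim : Module.finrank ℝ (EuclideanSpace ℝ (Fin n)) = n := by simp
  have : Nontrivial (EuclideanSpace ℝ (Fin n)) :=
    Module.nontrivial_of_finrank_pos (R := ℝ) (by rw [hdim]; omega)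
  rw [integrable_fun_norm_addHaar (volume : Measure (EuclideanSpace ℝ (Fin n)))
    (f := (Iio R).indicator (fun r : ℝ => K * r ^ (-s))), hdim]
  have h1 : IntervalIntegrable (fun r : ℝ => r ^ ((n : ℝ) - 1 - s)) volume 0 (max R 0) :=
    intervalIntegral.intervalIntegrable_rpow' (by linarith)
  rw [intervalIntegrable_iff_integrableOn_Ioc_of_le (le_max_right _ _)] at h1
  have h2 : IntegrableOn (fun r : ℝ => K * r ^ ((n : ℝ) - 1 - s)) (Ioc 0 (max R 0)) :=
    h1.const_mul K
  have h3 := (h2.mono_set (s := Ioo 0 (max R 0)) Ioo_subset_Ioc_self).integrable_indicator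
    measurableSet_Ioo
  refine h3.integrableOn.congr_fun ?_ measurableSet_Ioi
  intro r hr
  have hr' : 0 < r := hr
  by_cases h : r < R
  · have : r ∈ Ioo 0 (max R 0) := ⟨hr', lt_max_of_lt_left h⟩
    simp only [indicator_of_mem this, indicator_of_mem (show r ∈ Iio R from h), smul_eq_mul]
    have e : (n : ℝ) - 1 - s = ((n - 1 : ℕ) : ℝ) + (-s) := by
      rw [Nat.cast_sub (by omega)]; push_cast; ring
    rw [e, Real.rpow_add hr', Real.rpow_natCast]; ring
  · have : r ∉ Ioo 0 (max R 0) := by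
      rintro ⟨_, h'⟩
      rcases lt_max_iff.1 h' with h' | h'
      · exact h h'
      · exact absurd hr' (not_lt.2 h'.le)
    simp [indicator_of_notMem this, indicator_of_notMem (show r ∉ Iio R from h)]

lemma integrable_of_bound (hn : 2 ≤ n) {s : ℝ} (hs : s < n) (R K : ℝ)
    {G : EuclideanSpace ℝ (Fin n) → ℝ} (hm : Measurable G)
    (h0 : ∀ x, R ≤ ‖x‖ → x ≠ 0 → G x = 0) (hb : ∀ x, x ≠ 0 → |G x| ≤ K * ‖x‖ ^ (-s)) :
    Integrable G := by
  have hdim : Module.finrank ℝ (EuclideanSpace ℝ (Fin n)) = n := by simp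
  have : Nontrivial (EuclideanSpace ℝ (Fin n)) :=
    Module.nontrivial_of_finrank_pos (R := ℝ) (by rw [hdim]; omega)
  refine (integrable_dom hn hs R K).mono' hm.aestronglyMeasurable ?_
  have : ∀ᵐ x : EuclideanSpace ℝ (Fin n), x ≠ 0 := by
    simp [ae_iff]
  filter_upwards [this] with x hx
  by_cases h : ‖x‖ < R
  · rw [indicator_of_mem (show ‖x‖ ∈ Iio R from h)]
    exact hb x hx
  · rw [indicator_of_notMem (show ‖x‖ ∉ Iio R from h), h0 x (not_lt.1 h) hx]
    simp

end
end Rellich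

open Rellich

/-- Euclidean case of Theorem 4.2: the Rellich inequality connecting first and
second order radial derivatives. -/
theorem rellich_radial_onetwo (n : ℕ) (hn : 2 ≤ n) (p β : ℝ) (hp1 : 1 < p) (hpn : p < n)
    (hβl : -(n * (p - 1)) < β) (hβu : β < n - p)
    (f : EuclideanSpace ℝ (Fin n) → ℝ) (hf : ContDiff ℝ (⊤ : ℕ∞) f) (hfc : HasCompactSupport f) :
    ∫ x : EuclideanSpace ℝ (Fin n), |radLap f x| ^ p / ‖x‖ ^ β ≥
      ((n * (p - 1) + β) / p) ^ p *
        ∫ x : EuclideanSpace ℝ (Fin n), |radDeriv f x| ^ p / ‖x‖ ^ (p + β) := by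
  have hp0 : 0 < p := by linarith
  have hpz : p ≠ 0 := hp0.ne'
  obtain ⟨R, C, hR, hC, hz, hb1, hbL, hzz⟩ := bounds hn hf hfc
  set c : ℝ := (n * (p - 1) + β) / p with hcdef
  have hc : 0 < c := div_pos (by linarith) hp0
  have hpc : p * c = n * (p - 1) + β := by rw [hcdef]; field_simp
  have hs : p + β < n := by linarith
  have mD := measurable_radDeriv f
  have mL := measurable_radLap f
  have mN : Measurable fun x : EuclideanSpace ℝ (Fin n) => ‖x‖ := measurable_norm
  have mA : Measurable fun x => |radDeriv f x| := mD.norm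
  have mLA : Measurable fun x => |radLap f x| := mL.norm
  -- integrability
  have I1 : Integrable fun x : EuclideanSpace ℝ (Fin n) => |radLap f x| ^ p / ‖x‖ ^ β := by
    refine integrable_of_bound hn hs R (C ^ p)
      ((mLA.pow_const p).div (mN.pow_const β)) ?_ ?_
    · intro x hx _
      rw [(hzz x hx).2]; simp [Real.zero_rpow hpz]
    · intro x hx
      have hpos : 0 < ‖x‖ := norm_pos_iff.2 hx
      rw [abs_of_nonneg (by positivity), Real.rpow_neg hpos.le, Real.rpow_add hpos, mul_inv,
        ← mul_assoc, ← div_eq_mul_inv, ← div_eq_mul_inv, ← Real.div_rpow hC.le hpos.le]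
      gcongr
      exact hbL x hx
  have I2 : Integrable fun x : EuclideanSpace ℝ (Fin n) =>
      |radDeriv f x| ^ p / ‖x‖ ^ (p + β) := by
    refine integrable_of_bound hn hs R (C ^ p)
      ((mA.pow_const p).div (mN.pow_const (p + β))) ?_ ?_
    · intro x hx _
      rw [(hzz x hx).1]; simp [Real.zero_rpow hpz]
    · intro x hx
      have hpos : 0 < ‖x‖ := norm_pos_iff.2 hx
      rw [abs_of_nonneg (by positivity), Real.rpow_neg hpos.le, ← div_eq_mul_inv]
      gcongr
      exact hb1 x
  have I3 : Integrable fun x : EuclideanSpace ℝ (Fin n) =>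
      |radDeriv f x| ^ (p - 2) * radDeriv f x * radLap f x * ‖x‖ ^ (1 - p - β) := by
    refine integrable_of_bound hn hs R (C ^ p)
      ((((mA.pow_const (p - 2)).mul mD).mul mL).mul (mN.pow_const (1 - p - β))) ?_ ?_
    · intro x hx _
      rw [(hzz x hx).1]; simp
    · intro x hx
      have hpos : 0 < ‖x‖ := norm_pos_iff.2 hx
      rw [abs_mul, abs_mul, abs_rpow_mul_self hp1, abs_of_nonneg (Real.rpow_nonneg hpos.le _)]
      have e : C ^ p * ‖x‖ ^ (-(p + β)) = C ^ (p - 1) * (C / ‖x‖) * ‖x‖ ^ (1 - p - β) := by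
        have e1 : 1 - p - β = -(p + β) + 1 := by ring
        have e2 : C ^ p = C ^ (p - 1) * C := by
          rw [← Real.rpow_add_one hC.ne']; congr 1; ring
        rw [e1, Real.rpow_add_one hpos.ne', e2]
        field_simp
      rw [e]
      have := Real.rpow_le_rpow (abs_nonneg _) (hb1 x) (by linarith : 0 ≤ p - 1)
      have := hbL x hx
      gcongr
  set G : EuclideanSpace ℝ (Fin n) → ℝ := fun x =>
    |radDeriv f x| ^ (p - 2) * radDeriv f x * radLap f x * ‖x‖ ^ (1 - p - β)
      - c * (|radDeriv f x| ^ p / ‖x‖ ^ (p + β)) with hGdef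
  have IG : Integrable G := I3.sub (I2.const_mul c)
  have hG0 : ∫ x, G x = 0 := by
    refine integral_eq_zero_of_rays hn G IG ?_
    intro w hw hint
    set g : ℝ → ℝ := fun s => fderiv ℝ f (s • w) w with hg
    have hgc : Continuous g :=
      continuous_iff_continuousAt.2 fun s => (hasDerivAt_ray hf w s).continuousAt
    set F : ℝ → ℝ := fun r => |g r| ^ p * r ^ ((n : ℝ) - p - β) with hF
    have hFc : Continuous F :=
      (hgc.abs.rpow_const fun _ => Or.inr hp0.le).mul
        (continuous_id.rpow_const fun _ => Or.inr (by linarith))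
    have hF0 : F 0 = 0 := by
      simp only [hF]
      rw [Real.zero_rpow (by linarith), mul_zero]
    have hderiv : ∀ r ∈ Ioi (0 : ℝ), HasDerivAt F (p * (r ^ (n - 1) * G (r • w))) r := by
      intro r hr
      have hr : 0 < r := hr
      have h1 := (hasDerivAt_abs_rpow (g r) hp1).comp r (hasDerivAt_ray hf w r)
      have h2 := Real.hasDerivAt_rpow_const (x := r) (p := (n : ℝ) - p - β) (Or.inl hr.ne')
      have h3 := h1.mul h2
      refine h3.congr_deriv ?_
      have hnorm : ‖r • w‖ = r := by rw [norm_smul, hw, mul_one, Real.norm_of_nonneg hr.le]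
      simp only [hGdef, hnorm, radLap, radDeriv2_ray hf hw hr, radDeriv_ray f hw hr,
        Function.comp_apply]
      change p * |g r| ^ (p - 2) * g r * _ * _ + |g r| ^ p * _ = p * (_ * (|g r| ^ (p - 2) * g r *
        (_ + _ * g r) * _ - c * (|g r| ^ p / _)))
      have habs : |g r| ^ (p - 2) * g r * g r = |g r| ^ p := by
        rcases eq_or_ne (g r) 0 with h | h
        · rw [h]; simp [Real.zero_rpow hpz]
        · have e : p = (p - 2) + (2 : ℕ) := by push_cast; ring
          conv_rhs => rw [e, Real.rpow_add_natCast (abs_ne_zero.2 h), sq_abs]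
          ring
      have q1 : r ^ ((n : ℝ) - p - β) = r ^ (n - 1) * r ^ (1 - p - β) := by
        rw [← Real.rpow_natCast, ← Real.rpow_add hr, Nat.cast_sub (by omega)]
        congr 1; push_cast; ring
      have q2 : r ^ ((n : ℝ) - p - β - 1) = r ^ (n - 1) * (r ^ (p + β))⁻¹ := by
        rw [← Real.rpow_neg hr.le, ← Real.rpow_natCast, ← Real.rpow_add hr,
          Nat.cast_sub (by omega)]
        congr 1; push_cast; ring
      have q3 : r ^ (1 - p - β) = r * (r ^ (p + β))⁻¹ := by
        rw [← Real.rpow_neg hr.le, mul_comm, ← Real.rpow_add_one hr.ne']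
        congr 1; ring
      rw [q1, q2, q3, ← habs]
      have hA : r ^ (p + β) ≠ 0 := by positivity
      have hcc : c = (n * (p - 1) + β) / p := hcdef
      rw [hcc]
      field_simp
      ring
    have htop : Tendsto F atTop (𝓝 0) := by
      refine tendsto_const_nhds.congr' ?_
      filter_upwards [eventually_ge_atTop R] with r hr
      have hr0 : 0 < r := hR.trans_le hr
      have hnorm : ‖r • w‖ = r := by rw [norm_smul, hw, mul_one, Real.norm_of_nonneg hr0.le]
      simp only [hF, hg]
      rw [hz (r • w) (by rw [hnorm]; exact hr)]
      simp [Real.zero_rpow hpz]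
    have := integral_Ioi_of_hasDerivAt_of_tendsto hFc.continuousWithinAt hderiv
      (hint.const_mul p) htop
    rw [hF0, sub_zero, integral_const_mul] at this
    exact (mul_eq_zero.1 this).resolve_left hpz
  have hdim : Module.finrank ℝ (EuclideanSpace ℝ (Fin n)) = n := by simp
  have : Nontrivial (EuclideanSpace ℝ (Fin n)) :=
    Module.nontrivial_of_finrank_pos (R := ℝ) (by rw [hdim]; omega)
  have hae : ∀ᵐ x : EuclideanSpace ℝ (Fin n), x ≠ 0 := by
    simp [ae_iff]
  have hmono : ∫ x, p * c ^ (p - 1) * G x ≤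
      ∫ x : EuclideanSpace ℝ (Fin n), (|radLap f x| ^ p / ‖x‖ ^ β
        - c ^ p * (|radDeriv f x| ^ p / ‖x‖ ^ (p + β))) := by
    refine integral_mono_ae (IG.const_mul _) (I1.sub (I2.const_mul _)) ?_
    filter_upwards [hae] with x hx
    have hpos : 0 < ‖x‖ := norm_pos_iff.2 hx
    have := pointwise_aux (β := β) hp1 hc hpos (radDeriv f x) (radLap f x)
    have e : ‖x‖ ^ (-p - β) = (‖x‖ ^ (p + β))⁻¹ := by
      rw [← Real.rpow_neg hpos.le]; congr 1; ring
    rw [e] at this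
    simp only [hGdef]
    rw [div_eq_mul_inv _ (‖x‖ ^ (p + β)), ← mul_assoc c]
    rwa [div_eq_mul_inv _ (‖x‖ ^ (p + β))] at this
  rw [integral_const_mul, hG0, mul_zero, integral_sub I1 (I2.const_mul _),
    integral_const_mul] at hmono
  linarith
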